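/- (Sensitivity of the averaged clipped gradient in DP-SGD.) Let E be a real inner product space, C > 0, n ≥ 1, and let g, g' : Fin n → E be two families of per-example gradients that agree at every index except possibly one index i₀ (i.e., g i = g' i for all i ≠ i₀). Then the averaged clipped gradients satisfy ‖(1/n)·∑ᵢ clip(g i, C) − (1/n)·∑ᵢ clip(g' i, C)‖ ≤ 2C/n. Hence per-example gradient clipping limits the L2-sensitivity of the averaged gradient to 2C/n. -/

import Mathlib

open Finset

/-- Per-example gradient clipping: project `u` to the closed ball of radius `C`. -/
noncomputable def clip {E : Type*} [NormedAddCommGroup E] [InnerProductSpace ℝ E]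
    (C : ℝ) (u : E) : E :=
  if ‖u‖ ≤ C then u else (C / ‖u‖) • u

theorem norm_clip_le {E : Type*} [NormedAddCommGroup E] [InnerProductSpace ℝ E]
    {C : ℝ} (hC : 0 < C) (u : E) : ‖clip C u‖ ≤ C := by
  unfold clip
  split_ifs with h
  · exact h
  · have hu : 0 < ‖u‖ := hC.trans (not_le.mp h)
    rw [norm_smul, norm_div, norm_norm, Real.norm_of_nonneg hC.le, div_mul_cancel₀ _ hu.ne']

/-- Sensitivity of the averaged clipped gradient in DP-SGD: if two families of
per-example gradients differ in at most one example, then the averaged clipped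
gradients differ in norm by at most `2C/n`. -/
theorem averaged_clipped_gradient_sensitivity
    {E : Type*} [NormedAddCommGroup E] [InnerProductSpace ℝ E]
    (C : ℝ) (hC : 0 < C) (n : ℕ) (hn : 1 ≤ n)
    (g g' : Fin n → E) (i₀ : Fin n)
    (hgg' : ∀ i, i ≠ i₀ → g i = g' i) :
    ‖(1 / (n : ℝ)) • ∑ i, clip C (g i) - (1 / (n : ℝ)) • ∑ i, clip C (g' i)‖
      ≤ 2 * C / n := by
  have hsum : ∑ i, clip C (g i) - ∑ i, clip C (g' i) = clip C (g i₀) - clip C (g' i₀) := by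
    rw [← Finset.sum_sub_distrib]
    refine Finset.sum_eq_single i₀ (fun i _ hi => ?_) (fun h => absurd (Finset.mem_univ _) h)
    rw [hgg' i hi, sub_self]
  have hdiff : ‖clip C (g i₀) - clip C (g' i₀)‖ ≤ 2 * C :=
    (norm_sub_le _ _).trans <| by
      linarith [norm_clip_le hC (g i₀), norm_clip_le hC (g' i₀)]
  rw [← smul_sub, hsum, norm_smul, Real.norm_of_nonneg (by positivity), one_div_mul_eq_div]
  gcongr
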